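/- Let n ≥ 2, and let k satisfy 2 ≤ k ≤ n+2 if n ≥ 3, and k ∈ {2,3} if n = 2. Let g ∈ SL_{2n}(ℝ). Then the set {(⟨v_i, v_j⟩^g)_{1≤i<j≤k} : v_1, …, v_k ∈ ℤ^{2n}} is dense in ℝ^{k(k−1)/2} if and only if the symplectic form ⟨·,·⟩^g is irrational. -/

import Mathlib

open Matrix MeasureTheory

noncomputable section

abbrev Pairs (k : ℕ) := {p : Fin k × Fin k // p.1 < p.2}

/-- The standard symplectic matrix `J_n` with block form `(0 Iₙ; -Iₙ 0)`. -/
def Jmat (n : ℕ) : Matrix (Fin (2*n)) (Fin (2*n)) ℝ :=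
  fun i j => if (i : ℕ) + n = (j : ℕ) then 1 else if (j : ℕ) + n = (i : ℕ) then -1 else 0

/-- The standard symplectic form `⟨v,w⟩ = vᵀ Jₙ w` on `ℝ^{2n}`. -/
def symp (n : ℕ) (v w : Fin (2*n) → ℝ) : ℝ := v ⬝ᵥ (Jmat n).mulVec w

abbrev SL2n (n : ℕ) := Matrix.SpecialLinearGroup (Fin (2*n)) ℝ

/-- The symplectic form `⟨v,w⟩^g = ⟨g v, g w⟩` attached to `g ∈ SL_{2n}(ℝ)`. -/
def sympG (n : ℕ) (g : SL2n n) (v w : Fin (2*n) → ℝ) : ℝ :=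
  symp n ((g : Matrix (Fin (2*n)) (Fin (2*n)) ℝ).mulVec v)
         ((g : Matrix (Fin (2*n)) (Fin (2*n)) ℝ).mulVec w)

/-- Euclidean norm on `ℝ^d` (presented as `Fin d → ℝ`). -/
def enorm2 {d : ℕ} (v : Fin d → ℝ) : ℝ := Real.sqrt (∑ i, (v i)^2)

/-- The form `⟨·,·⟩^g` is rational: some nonzero scalar multiple of `gᵀ Jₙ g` has
integer entries. -/
def IsRationalForm (n : ℕ) (g : SL2n n) : Prop :=
  ∃ c : ℝ, c ≠ 0 ∧ ∀ i j, ∃ m : ℤ,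
    c * (((g : Matrix (Fin (2*n)) (Fin (2*n)) ℝ)ᵀ * Jmat n *
          (g : Matrix (Fin (2*n)) (Fin (2*n)) ℝ)) i j) = (m : ℝ)


def IsAlt {L : Type*} [AddCommGroup L] (B : L → L → ℝ) : Prop :=
  (∀ x y z, B (x + y) z = B x z + B y z) ∧ (∀ x y, B x y = - B y x)

def IsAddF {L : Type*} [AddCommGroup L] (f : L → ℝ) : Prop := ∀ x y, f (x + y) = f x + f y

def Irr {L : Type*} (B : L → L → ℝ) : Prop := ∃ x y z w, Irrational (B x y / B z w)

def Dec {L : Type*} [AddCommGroup L] : ℕ → (L → L → ℝ) → Prop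
  | 0, B => ∀ x y, B x y = 0
  | m + 1, B => ∃ f h : L → ℝ, IsAddF f ∧ IsAddF h ∧
      Dec m (fun x y => B x y - (f x * h y - f y * h x))

def DecG {ι : Type*} : ℕ → (ι → ι → ℝ) → Prop
  | 0, B => ∀ x y, B x y = 0
  | m + 1, B => ∃ f h : ι → ℝ, DecG m (fun x y => B x y - (f x * h y - f y * h x))

def schur {L : Type*} (B : L → L → ℝ) (v s : L) : L → L → ℝ :=
  fun z w => B z w - (B v z * B s w - B v w * B s z) / B v s

section
variable {L : Type*} [AddCommGroup L] {B : L → L → ℝ}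

lemma IsAlt.add_right (hB : IsAlt B) (x y z : L) : B x (y + z) = B x y + B x z := by
  rw [hB.2 x (y+z), hB.1, hB.2 x y, hB.2 x z]; ring

lemma IsAlt.self (hB : IsAlt B) (x : L) : B x x = 0 := by
  have := hB.2 x x; linarith

def IsAlt.hom (hB : IsAlt B) (v : L) : L →+ ℝ := AddMonoidHom.mk' (B v) (hB.add_right v)

lemma IsAlt.zsmul_right (hB : IsAlt B) (x : L) (m : ℤ) (z : L) : B x (m • z) = m * B x z := by
  have := map_zsmul (hB.hom x) m z
  simpa [IsAlt.hom] using this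

lemma IsAlt.zsmul_left (hB : IsAlt B) (x : L) (m : ℤ) (z : L) : B (m • z) x = m * B z x := by
  rw [hB.2, hB.zsmul_right, hB.2 x z]; ring

lemma IsAlt.schur (hB : IsAlt B) (v s : L) : IsAlt (schur B v s) := by
  refine ⟨fun x y z => ?_, fun x y => ?_⟩
  · simp only [_root_.schur, hB.1, hB.add_right]; ring
  · simp only [_root_.schur]; rw [hB.2 x y]; ring

lemma Dec.succ {m : ℕ} : ∀ {B : L → L → ℝ}, Dec m B → Dec (m+1) B := by
  intro B h
  refine ⟨fun _ => 0, fun _ => 0, fun _ _ => by simp, fun _ _ => by simp, ?_⟩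
  simpa using h

lemma Dec.mono {m m' : ℕ} (h : m ≤ m') (hd : Dec m B) : Dec m' B := by
  induction h with
  | refl => exact hd
  | step _ ih => exact ih.succ

lemma Dec.of_schur (hB : IsAlt B) {m : ℕ} {v s : L} (h : Dec m (schur B v s)) : Dec (m+1) B := by
  refine ⟨B v, fun z => B s z / B v s, hB.add_right v, fun x y => ?_, ?_⟩
  · simp only [hB.add_right]; ring
  · convert h using 3
    simp only [schur]; ring

lemma rat_of_not_irr {x : ℝ} (h : ¬ Irrational x) : ∃ q : ℚ, x = q := by
  simp only [Irrational, not_not] at h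
  obtain ⟨q, hq⟩ := h
  exact ⟨q, hq.symm⟩

lemma comm_of_not_irr {x y : ℝ} (hy : y ≠ 0) (h : ¬ Irrational (x / y)) : ∃ q : ℚ, x = q * y := by
  obtain ⟨q, hq⟩ := rat_of_not_irr h
  exact ⟨q, by field_simp at hq; linarith⟩

lemma not_irr_of_eq {x y : ℝ} (a b : ℚ) (hb : b ≠ 0) (h : a * x = b * y) :
    ¬ Irrational (y / x) := by
  intro hi
  by_cases hx : x = 0
  · subst hx; simp at hi
  · apply hi
    refine ⟨a / b, ?_⟩
    have : (b : ℝ) ≠ 0 := by exact_mod_cast hb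
    push_cast
    rw [div_eq_div_iff this hx]; linarith

lemma exists_row (hB : IsAlt B) (hI : Irr B) : ∃ v p q, Irrational (B v p / B v q) := by
  by_contra hc
  push Not at hc
  have key : ∀ v p q, B v q ≠ 0 → ∃ r : ℚ, B v p = r * B v q := fun v p q h =>
    comm_of_not_irr h (hc v p q)
  have key' : ∀ v p q, B q v ≠ 0 → ∃ r : ℚ, B p v = r * B q v := fun v p q h => by
    obtain ⟨r, hr⟩ := key v p q (by rw [hB.2]; simpa using h)
    exact ⟨r, by rw [hB.2 p, hB.2 q, hr]; ring⟩
  obtain ⟨z, w, x, y, h⟩ := hI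
  have h1 : B x y ≠ 0 := by intro h0; rw [h0] at h; simp at h
  have h2 : B z w ≠ 0 := by intro h0; rw [h0] at h; simp at h
  -- goal: B z w = r * B x y
  suffices ∃ r : ℚ, B z w = r * B x y by
    obtain ⟨r, hr⟩ := this
    exact not_irr_of_eq r 1 one_ne_zero (by rw [hr]; simp) h
  by_cases hxw : B x w = 0
  · by_cases hzy : B z y = 0
    · obtain ⟨r, hr⟩ := key (x + z) w y (by rw [hB.1, hzy]; simpa using h1)
      rw [hB.1, hB.1, hxw, hzy] at hr
      exact ⟨r, by simpa using hr⟩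
    · obtain ⟨r, hr⟩ := key z w y hzy
      obtain ⟨r', hr'⟩ := key' y z x h1
      exact ⟨r * r', by rw [hr, hr']; push_cast; ring⟩
  · obtain ⟨r, hr⟩ := key' w z x hxw
    obtain ⟨r', hr'⟩ := key x w y h1
    exact ⟨r * r', by rw [hr, hr']; push_cast; ring⟩

lemma exists_tiny (hB : IsAlt B) (hI : Irr B) {ε : ℝ} (hε : 0 < ε) :
    ∃ v x y, 0 < B v x ∧ B v x < ε ∧ Irrational (B v y / B v x) := by
  obtain ⟨v, p, q, h⟩ := exists_row hB hI
  obtain ⟨x, hx0, hx1⟩ : ∃ x, 0 < B v x ∧ B v x < ε := by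
    rcases AddSubgroup.dense_or_cyclic (hB.hom v).range with hd | ⟨a, ha⟩
    · obtain ⟨t, ht, ht'⟩ := hd.exists_between hε
      obtain ⟨x, rfl⟩ := ht
      exact ⟨x, ht'⟩
    · exfalso
      have mem : ∀ u, ∃ m : ℤ, B v u = m * a := by
        intro u
        have : B v u ∈ (hB.hom v).range := ⟨u, rfl⟩
        rw [ha, AddSubgroup.mem_closure_singleton] at this
        obtain ⟨m, hm⟩ := this
        exact ⟨m, by rw [← hm]; simp⟩
      obtain ⟨m, hm⟩ := mem p
      obtain ⟨m', hm'⟩ := mem q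
      have hm0 : m' ≠ 0 := by
        rintro rfl
        rw [hm'] at h; simp at h
      exact not_irr_of_eq m m' (by exact_mod_cast hm0) (by rw [hm, hm']; push_cast; ring) h
  by_cases hp : Irrational (B v p / B v x)
  · exact ⟨v, x, p, hx0, hx1, hp⟩
  · refine ⟨v, x, q, hx0, hx1, ?_⟩
    by_contra hq
    obtain ⟨r, hr⟩ := comm_of_not_irr hx0.ne' hp
    obtain ⟨r', hr'⟩ := comm_of_not_irr hx0.ne' hq
    have hm0 : r' ≠ 0 := by
      rintro rfl
      rw [hr'] at h; simp at h
    exact not_irr_of_eq r r' hm0 (by rw [hr, hr']; ring) h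

lemma exists_pair (hB : IsAlt B) (hI : Irr B) {ε : ℝ} (hε : 0 < ε) :
    ∃ v s, 0 < B v s ∧ B v s < ε ∧ (¬ Dec 2 B → Irr (schur B v s)) := by
  obtain ⟨v, x, y0, hx0, hx1, hy0⟩ := exists_tiny hB hI hε
  by_cases hx : (¬ Dec 2 B → Irr (schur B v x))
  · exact ⟨v, x, hx0, hx1, hx⟩
  push Not at hx
  obtain ⟨hD, hnx⟩ := hx
  set a := B v with ha
  let Ω : L → L → L → ℝ := fun x y z => a x * B y z - a y * B x z + a z * B x y
  have Ωself : ∀ x z, Ω x x z = 0 := fun x z => by simp [Ω, hB.self]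
  have aadd : ∀ x y, a (x + y) = a x + a y := hB.add_right v
  have Ωadd : ∀ x y y' z, Ω x (y + y') z = Ω x y z + Ω x y' z := fun x y y' z => by
    simp only [Ω, hB.1, hB.add_right, aadd]; ring
  have Ωadd3 : ∀ x y z z', Ω x y (z + z') = Ω x y z + Ω x y z' := fun x y z z' => by
    simp only [Ω, hB.add_right, aadd]; ring
  have asm : ∀ (m : ℤ) x, a (m • x) = m * a x := fun m x => hB.zsmul_right v m x
  have Ωsm : ∀ x (m : ℤ) y z, Ω x (m • y) z = m * Ω x y z := fun x m y z => by
    simp only [Ω, hB.zsmul_left, hB.zsmul_right, asm]; ring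
  have Ωsw : ∀ x y z, Ω y x z = - Ω x y z := fun x y z => by
    simp only [Ω]; rw [hB.2 y x]; ring
  have hsch : ∀ s z w, a s ≠ 0 → schur B v s z w = Ω s z w / a s := fun s z w hs => by
    simp only [schur, Ω, ← ha]; field_simp; ring
  -- there is t with Ω x t ≠ 0
  obtain ⟨t, u, htu⟩ : ∃ t u, Ω x t u ≠ 0 := by
    by_contra hc
    push Not at hc
    apply hD
    apply Dec.succ
    apply Dec.of_schur hB (v := v) (s := x)
    intro z w
    rw [hsch x z w hx0.ne', hc, zero_div]
  obtain ⟨y1, u, hy1, hu1⟩ : ∃ y1 u, Irrational (a y1 / a x) ∧ Ω x y1 u ≠ 0 := by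
    by_cases h0 : Ω x y0 u = 0
    · by_cases ht : Irrational (a t / a x)
      · exact ⟨t, u, ht, htu⟩
      · refine ⟨t + y0, u, ?_, by rw [Ωadd, h0, add_zero]; exact htu⟩
        obtain ⟨r, hr⟩ := rat_of_not_irr ht
        rw [aadd, add_div, hr]
        exact hy0.ratCast_add r
    · exact ⟨y0, u, hy0, h0⟩
  obtain ⟨y, hy, hu, hya, hyb⟩ : ∃ y, Irrational (a y / a x) ∧ Ω x y u ≠ 0 ∧ 0 < a y ∧ a y < ε := by
    refine ⟨y1 + (-⌊a y1 / a x⌋) • x, ?_⟩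
    have e1 : a (y1 + (-⌊a y1 / a x⌋) • x) = a y1 - ⌊a y1 / a x⌋ * a x := by
      rw [aadd, asm]; push_cast; ring
    have e2 : a (y1 + (-⌊a y1 / a x⌋) • x) / a x = a y1 / a x - ⌊a y1 / a x⌋ := by
      rw [e1]; field_simp
    have i1 : Irrational (a (y1 + (-⌊a y1 / a x⌋) • x) / a x) := by
      rw [e2]; exact hy1.sub_intCast _
    have f1 := Int.floor_le (a y1 / a x)
    have f2 := Int.lt_floor_add_one (a y1 / a x)
    have g1 : 0 ≤ a (y1 + (-⌊a y1 / a x⌋) • x) / a x := by rw [e2]; linarith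
    have g2 : a (y1 + (-⌊a y1 / a x⌋) • x) / a x < 1 := by rw [e2]; linarith
    refine ⟨i1, ?_, ?_, ?_⟩
    · rw [Ωadd, Ωsm, Ωself]; simpa using hu1
    · have : 0 < a (y1 + (-⌊a y1 / a x⌋) • x) / a x := lt_of_le_of_ne g1 i1.ne_zero.symm
      exact (div_pos_iff_of_pos_right hx0).1 this
    · rw [div_lt_one hx0] at g2; linarith
  refine ⟨v, y, hya, hyb, fun _ => ?_⟩
  by_contra hny
  simp only [Irr, not_exists] at hnx hny
  set l := Ω x y u with hl
  have qx : ∀ z w, ∃ q : ℚ, Ω x z w = q * l := fun z w => by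
    have := hnx z w y u
    rw [hsch _ _ _ hx0.ne', hsch _ _ _ hx0.ne', div_div_div_cancel_right₀ hx0.ne'] at this
    exact comm_of_not_irr hu this
  have qy : ∀ z w, ∃ q : ℚ, Ω y z w = q * l := fun z w => by
    have := hny z w x u
    rw [hsch _ _ _ hya.ne', hsch _ _ _ hya.ne', div_div_div_cancel_right₀ hya.ne'] at this
    obtain ⟨q, hq⟩ := comm_of_not_irr (by rw [Ωsw]; simpa using hu) this
    exact ⟨-q, by rw [hq, Ωsw]; push_cast; ring⟩
  have idn : ∀ z w, a x * Ω y z w - a y * Ω x z w + a z * Ω x y w - a w * Ω x y z = 0 := by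
    intro z w; simp only [Ω]; rw [hB.2 z w]; ring_nf
  have key : ∀ z w, Ω x z w = (Ω x y z * Ω x u w - Ω x y w * Ω x u z) / l := by
    intro z w
    obtain ⟨qz, hqz⟩ := qx y z
    obtain ⟨qw, hqw⟩ := qx y w
    obtain ⟨r1, h1⟩ := qx z w
    obtain ⟨r2, h2⟩ := qx u w
    obtain ⟨r3, h3⟩ := qx z u
    obtain ⟨s1, k1⟩ := qy z w
    obtain ⟨s2, k2⟩ := qy u w
    obtain ⟨s3, k3⟩ := qy z u
    have h3' : Ω x u z = - (r3 * l) := by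
      rw [← h3]; simp only [Ω]; rw [hB.2 u z]; ring
    have j1 := idn z w
    have j2 := idn u w
    have j3 := idn z u
    rw [hqz, hqw, h1, k1] at j1
    rw [← hl, hqw, h2, k2] at j2
    rw [← hl, hqz, h3, k3] at j3
    have j : (a x * (s1 - qz * s2 - qw * s3) - a y * (r1 - qz * r2 - qw * r3)) * l = 0 := by
      linear_combination j1 - qz * j2 - qw * j3
    have j' := (mul_eq_zero.1 j).resolve_right hu
    have : r1 - qz * r2 - qw * r3 = 0 := by
      by_contra hr
      exact not_irr_of_eq (s1 - qz * s2 - qw * s3) (r1 - qz * r2 - qw * r3) hr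
        (by push_cast; linarith) hy
    have hr : (r1 : ℝ) - qz * r2 - qw * r3 = 0 := by exact_mod_cast this
    rw [eq_div_iff hu, hqz, hqw, h1, h2, h3']
    linear_combination l * l * hr
  apply hD
  apply Dec.of_schur hB (v := v) (s := x)
  refine ⟨Ω x y, fun w => Ω x u w / (l * a x), Ωadd3 x y, fun z w => ?_, fun z w => ?_⟩
  · simp only [Ωadd3]; ring
  · simp only
    rw [hsch _ _ _ hx0.ne', key]; field_simp; ring

theorem approx_main {ι : Type*} [Finite ι] : ∀ (m : ℕ) (B : L → L → ℝ), IsAlt B → (0 < m → Irr B) →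
    ¬ Dec m B → ∀ (G : ι → ι → ℝ), DecG m G → ∀ η : ℝ, 0 < η →
    ∃ z : ι → L, ∀ i j, |B (z i) (z j) - G i j| < η := by
  intro m
  induction m with
  | zero =>
    intro B hB _ _ G hG η hη
    refine ⟨fun _ => 0, fun i j => ?_⟩
    have h0 : B 0 0 = 0 := hB.self 0
    rw [h0, hG i j]; simpa using hη
  | succ m ih =>
    intro B hB hI hD G hG η hη
    obtain ⟨X, Y, hG'⟩ := hG
    obtain ⟨C, hC0, hX, hY⟩ : ∃ C : ℝ, 0 ≤ C ∧ (∀ i, |X i| ≤ C) ∧ ∀ i, |Y i| ≤ C := by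
      cases nonempty_fintype ι
      refine ⟨∑ i, (|X i| + |Y i|), by positivity, fun i => ?_, fun i => ?_⟩
      · have := Finset.single_le_sum (f := fun i => |X i| + |Y i|) (fun i _ => by positivity)
          (Finset.mem_univ i)
        have h2 := abs_nonneg (Y i)
        linarith
      · have := Finset.single_le_sum (f := fun i => |X i| + |Y i|) (fun i _ => by positivity)
          (Finset.mem_univ i)
        have h2 := abs_nonneg (X i)
        linarith
    set t0 : ℝ := min 1 (η / (4 * (2 * C + 1))) with ht0
    have ht0p : 0 < t0 := lt_min one_pos (by positivity)
    obtain ⟨v, s, hb0, hb1, hirr⟩ := exists_pair hB (hI (Nat.succ_pos m)) (ε := t0 ^ 2) (by positivity)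
    have hB' := hB.schur v s
    obtain ⟨z', hz'⟩ := ih (schur B v s) hB'
      (fun hm => hirr fun h2 => hD (h2.mono (by omega)))
      (fun h => hD (h.of_schur hB)) _ hG' (η / 2) (by positivity)
    set b := B v s with hb
    set t := √b with ht
    have htt : t * t = b := Real.mul_self_sqrt hb0.le
    have htp : 0 < t := Real.sqrt_pos.2 hb0
    have htlt : t < t0 := by
      rw [ht, Real.sqrt_lt' ht0p]; exact hb1
    have ht1 : t < 1 := lt_of_lt_of_le htlt (min_le_left _ _)
    have ht2 : t * (4 * (2 * C + 1)) < η := by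
      rw [← lt_div_iff₀ (by positivity)]; exact lt_of_lt_of_le htlt (min_le_right _ _)
    -- choose integers
    have rnd : ∀ r target : ℝ, ∃ q : ℤ, ∃ θ : ℝ, |θ| ≤ 1 ∧ r + q * b = t * target + b * θ := by
      intro r target
      refine ⟨round ((t * target - r) / b), round ((t * target - r) / b) - (t * target - r) / b, ?_, ?_⟩
      · have := abs_sub_round ((t * target - r) / b)
        rw [abs_sub_comm] at this; linarith
      · field_simp; ring
    choose q θ hθ hq using fun i => rnd (B v (z' i)) (X i)
    choose p φ hφ hp using fun i => rnd (B s (z' i)) (Y i)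
    refine ⟨fun i => z' i + (-p i) • v + q i • s, fun i j => ?_⟩
    have hsv : B s v = - b := by rw [hB.2]
    have e1 : ∀ i, B v (z' i + (-p i) • v + q i • s) = t * X i + b * θ i := by
      intro i
      rw [hB.add_right, hB.add_right, hB.zsmul_right, hB.zsmul_right, hB.self, ← hb, ← hq]; ring
    have e2 : ∀ i, B s (z' i + (-p i) • v + q i • s) = t * Y i + b * φ i := by
      intro i
      rw [hB.add_right, hB.add_right, hB.zsmul_right, hB.zsmul_right, hB.self, hsv, ← hp]
      push_cast; ring
    have sv : ∀ w, schur B v s v w = 0 := fun w => by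
      simp only [schur, hB.self, hsv, ← hb]; field_simp; ring
    have ss : ∀ w, schur B v s s w = 0 := fun w => by
      simp only [schur, hB.self, ← hb]; field_simp; ring
    have e3 : schur B v s (z' i + (-p i) • v + q i • s) (z' j + (-p j) • v + q j • s)
        = schur B v s (z' i) (z' j) := by
      rw [hB'.1, hB'.1, hB'.zsmul_left, hB'.zsmul_left, sv, ss]
      rw [hB'.add_right, hB'.add_right, hB'.zsmul_right, hB'.zsmul_right, hB'.2 _ v, hB'.2 _ s, sv, ss]
      ring
    have e4 : B (z' i + (-p i) • v + q i • s) (z' j + (-p j) • v + q j • s)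
        = schur B v s (z' i) (z' j) + ((t * X i + b * θ i) * (t * Y j + b * φ j)
          - (t * X j + b * θ j) * (t * Y i + b * φ i)) / b := by
      rw [← e3, ← e1, ← e1, ← e2, ← e2]
      simp only [schur]; ring
    have e5 : ((t * X i + b * θ i) * (t * Y j + b * φ j)
          - (t * X j + b * θ j) * (t * Y i + b * φ i)) / b =
        (X i * Y j - X j * Y i) + t * ((X i * φ j + θ i * Y j + t * (θ i * φ j))
          - (X j * φ i + θ j * Y i + t * (θ j * φ i))) := by
      rw [← htt]; field_simp; ring
    have bd : ∀ i j, |X i * φ j + θ i * Y j + t * (θ i * φ j)| ≤ 2 * C + 1 := by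
      intro i j
      have a1 : |X i * φ j| ≤ C * 1 := by
        rw [abs_mul]; exact mul_le_mul (hX i) (hφ j) (abs_nonneg _) hC0
      have a2 : |θ i * Y j| ≤ 1 * C := by
        rw [abs_mul]; exact mul_le_mul (hθ i) (hY j) (abs_nonneg _) zero_le_one
      have a3 : |t * (θ i * φ j)| ≤ 1 * (1 * 1) := by
        rw [abs_mul, abs_mul, abs_of_pos htp]
        exact mul_le_mul ht1.le (mul_le_mul (hθ i) (hφ j) (abs_nonneg _) zero_le_one)
          (by positivity) zero_le_one
      have := abs_add_three (X i * φ j) (θ i * Y j) (t * (θ i * φ j))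
      linarith
    have b1 := bd i j
    have b2 := bd j i
    have b3 := hz' i j
    simp only
    rw [e4, e5]
    set U := X i * φ j + θ i * Y j + t * (θ i * φ j)
    set W := X j * φ i + θ j * Y i + t * (θ j * φ i)
    have b4 : |t * (U - W)| ≤ t * (2 * (2 * C + 1)) := by
      rw [abs_mul, abs_of_pos htp]
      refine mul_le_mul_of_nonneg_left ?_ htp.le
      have := abs_sub U W
      linarith
    rw [abs_lt] at b3 ⊢
    rw [abs_le] at b4
    constructor <;> linarith [b3.1, b3.2, b4.1, b4.2]

end

lemma decG_of_supp {ι : Type*} [DecidableEq ι] : ∀ (m : ℕ) (S : Finset ι) (G : ι → ι → ℝ),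
    S.card ≤ 2 * m + 1 → (∀ i j, G i j = - G j i) → (∀ i j, i ∉ S → G i j = 0) → DecG m G := by
  intro m
  induction m with
  | zero =>
    intro S G hS hG h0 i j
    by_cases hi : i ∈ S
    · by_cases hj : j ∈ S
      · have := Finset.card_le_one.1 (by simpa using hS) i hi j hj
        subst this
        have := hG i i; linarith
      · rw [hG, h0 j i hj, neg_zero]
    · exact h0 i j hi
  | succ m ih =>
    intro S G hS hG h0
    by_cases hz : ∀ i j, G i j = 0
    · refine ⟨fun _ => 0, fun _ => 0, ?_⟩
      refine ih ∅ _ (by simp) (fun i j => by simp [hz]) (fun i j _ => by simp [hz])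
    · push Not at hz
      obtain ⟨a, b, hab⟩ := hz
      have gs : ∀ i, G i i = 0 := fun i => by have := hG i i; linarith
      have hne : a ≠ b := by rintro rfl; exact hab (gs a)
      have ha : a ∈ S := by by_contra h; exact hab (h0 _ _ h)
      have hb : b ∈ S := by by_contra h; exact hab (by rw [hG, h0 _ _ h, neg_zero])
      refine ⟨G a, fun z => G b z / G a b, ?_⟩
      refine ih ((S.erase a).erase b) _ ?_ ?_ ?_
      · rw [Finset.card_erase_of_mem (Finset.mem_erase.2 ⟨hne.symm, hb⟩), Finset.card_erase_of_mem ha]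
        omega
      · intro i j
        simp only
        rw [hG i j]; ring
      · intro i j hi
        simp only [Finset.mem_erase, not_and, ne_eq] at hi
        simp only
        by_cases hib : i = b
        · subst hib; rw [gs]; field_simp; ring
        · by_cases hia : i = a
          · subst hia; rw [gs, hG b i]; field_simp; ring
          · have hiS : i ∉ S := fun h => hi hib hia h
            rw [h0 i j hiS, hG a i, hG b i, h0 i a hiS, h0 i b hiS]; ring

lemma decG_fin {k m : ℕ} (hk : k ≤ 2 * m + 1) (G : Fin k → Fin k → ℝ)
    (hG : ∀ i j, G i j = - G j i) : DecG m G :=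
  decG_of_supp m Finset.univ G (by simpa using hk) hG (fun i j h => absurd (Finset.mem_univ i) h)

lemma mrank_add_le {N : ℕ} (A B : Matrix (Fin N) (Fin N) ℝ) :
    (A + B).rank ≤ A.rank + B.rank := by
  have h : LinearMap.range (A + B).mulVecLin ≤
      LinearMap.range A.mulVecLin ⊔ LinearMap.range B.mulVecLin := by
    rintro _ ⟨x, rfl⟩
    rw [Matrix.mulVecLin_add, LinearMap.add_apply]
    exact Submodule.add_mem_sup ⟨x, rfl⟩ ⟨x, rfl⟩
  exact (Submodule.finrank_mono h).trans (Submodule.finrank_add_le_finrank_add_finrank _ _)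

lemma Dec.rank_le {N : ℕ} : ∀ (m : ℕ) (B : (Fin N → ℤ) → (Fin N → ℤ) → ℝ), Dec m B →
    (Matrix.of fun i j => B (Pi.single i 1) (Pi.single j 1)).rank ≤ 2 * m := by
  intro m
  induction m with
  | zero =>
    intro B h
    have : (Matrix.of fun i j => B (Pi.single i 1) (Pi.single j 1)) = (0 : Matrix (Fin N) (Fin N) ℝ) := by
      ext i j; simpa using h _ _
    rw [this]; simp
  | succ m ih =>
    rintro B ⟨f, h, -, -, hd⟩
    have h1 := ih _ hd
    have e : (Matrix.of fun i j => B (Pi.single i 1) (Pi.single j 1) : Matrix (Fin N) (Fin N) ℝ) =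
      (Matrix.of fun i j => B (Pi.single i 1) (Pi.single j 1) -
        (f (Pi.single i 1) * h (Pi.single j 1) - f (Pi.single j 1) * h (Pi.single i 1)))
      + (vecMulVec (fun i => f (Pi.single i 1)) (fun j => h (Pi.single j 1))
      + vecMulVec (fun i => h (Pi.single i 1)) (fun j => - f (Pi.single j 1))) := by
      ext i j; simp [vecMulVec]; ring
    rw [e]
    refine (mrank_add_le _ _).trans ?_
    have h2 := mrank_add_le
      (vecMulVec (fun i : Fin N => f (Pi.single i 1)) (fun j : Fin N => h (Pi.single j 1)))
      (vecMulVec (fun i : Fin N => h (Pi.single i 1)) (fun j : Fin N => - f (Pi.single j 1)))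
    have h3 := Matrix.rank_vecMulVec_le (fun i : Fin N => f (Pi.single i 1)) (fun j : Fin N => h (Pi.single j 1))
    have h4 := Matrix.rank_vecMulVec_le (fun i : Fin N => h (Pi.single i 1)) (fun j : Fin N => - f (Pi.single j 1))
    omega

lemma Jmat_transpose (n : ℕ) (hn : 0 < n) : (Jmat n)ᵀ = - Jmat n := by
  ext i j
  simp only [Jmat, Matrix.transpose_apply, Matrix.neg_apply]
  split_ifs <;> first | omega | simp

lemma Jmat_isUnit (n : ℕ) (hn : 0 < n) : IsUnit (Jmat n) := by
  rw [← Matrix.mulVec_injective_iff_isUnit, ← Matrix.coe_mulVecLin, injective_iff_map_eq_zero]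
  intro w hw
  ext j
  by_cases hj : (j : ℕ) < n
  · have h := congrFun hw ⟨j + n, by omega⟩
    simp only [Matrix.mulVecLin_apply, Matrix.mulVec, dotProduct] at h
    rw [Finset.sum_eq_single j] at h
    · simp only [Jmat, Pi.zero_apply] at h
      rw [if_neg (by omega)] at h
      simpa using h
    · intro b _ hb
      have hb' : (b : ℕ) ≠ j := fun h => hb (Fin.ext h)
      have := b.2
      simp only [Jmat]
      rw [if_neg (by omega), if_neg (by omega), zero_mul]
    · simp
  · have h := congrFun hw ⟨j - n, by omega⟩
    simp only [Matrix.mulVecLin_apply, Matrix.mulVec, dotProduct] at h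
    rw [Finset.sum_eq_single j] at h
    · simp only [Jmat, Pi.zero_apply] at h
      rw [if_pos (by omega)] at h
      simpa using h
    · intro b _ hb
      have hb' : (b : ℕ) ≠ j := fun h => hb (Fin.ext h)
      have := b.2
      simp only [Jmat]
      rw [if_neg (by omega), if_neg (by omega), zero_mul]
    · simp

def Mg (n : ℕ) (g : SL2n n) : Matrix (Fin (2*n)) (Fin (2*n)) ℝ :=
  (g : Matrix (Fin (2*n)) (Fin (2*n)) ℝ)ᵀ * Jmat n * (g : Matrix (Fin (2*n)) (Fin (2*n)) ℝ)

lemma Mg_isUnit (n : ℕ) (hn : 0 < n) (g : SL2n n) : IsUnit (Mg n g) := by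
  have hg : IsUnit (g : Matrix (Fin (2*n)) (Fin (2*n)) ℝ) := by
    rw [Matrix.isUnit_iff_isUnit_det, g.det_coe]; exact isUnit_one
  exact (((Matrix.isUnit_transpose _).2 hg).mul (Jmat_isUnit n hn)).mul hg

lemma Mg_transpose (n : ℕ) (hn : 0 < n) (g : SL2n n) : (Mg n g)ᵀ = - Mg n g := by
  simp only [Mg, Matrix.transpose_mul, Matrix.transpose_transpose, Jmat_transpose n hn]
  simp [Matrix.mul_assoc]

lemma sympG_eq (n : ℕ) (g : SL2n n) (v w : Fin (2*n) → ℝ) :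
    sympG n g v w = v ⬝ᵥ (Mg n g).mulVec w := by
  simp only [sympG, symp, Mg]
  rw [← Matrix.mulVec_mulVec, ← Matrix.mulVec_mulVec, Matrix.dotProduct_mulVec v,
    Matrix.vecMul_transpose]

def Bf (n : ℕ) (g : SL2n n) (v w : Fin (2*n) → ℤ) : ℝ :=
  sympG n g (fun j => ((v j : ℤ) : ℝ)) (fun j => ((w j : ℤ) : ℝ))

lemma Bf_alt (n : ℕ) (hn : 0 < n) (g : SL2n n) : IsAlt (Bf n g) := by
  refine ⟨fun x y z => ?_, fun x y => ?_⟩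
  · simp only [Bf, sympG_eq]
    rw [← add_dotProduct]
    congr 1
    ext j; simp
  · simp only [Bf, sympG_eq]
    rw [Matrix.dotProduct_mulVec, ← Matrix.mulVec_transpose, Mg_transpose n hn, Matrix.neg_mulVec,
      neg_dotProduct, dotProduct_comm]

lemma Bf_single (n : ℕ) (g : SL2n n) (i j : Fin (2*n)) :
    Bf n g (Pi.single i 1) (Pi.single j 1) = Mg n g i j := by
  have h : ∀ i : Fin (2*n), (fun l => (((Pi.single i 1 : Fin (2*n) → ℤ) l : ℤ) : ℝ))
      = Pi.single i (1 : ℝ) := by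
    intro i; ext l
    by_cases hl : l = i
    · subst hl; simp
    · simp [Pi.single_eq_of_ne hl]
  simp only [Bf, sympG_eq, h]
  simp

lemma Bf_not_dec (n m : ℕ) (hn : 0 < n) (hm : m < n) (g : SL2n n) : ¬ Dec m (Bf n g) := by
  intro h
  have h1 := Dec.rank_le m _ h
  have h2 : (Matrix.of fun i j => Bf n g (Pi.single i 1) (Pi.single j 1)) = Mg n g := by
    ext i j; simp [Bf_single]
  rw [h2, Matrix.rank_of_isUnit _ (Mg_isUnit n hn g)] at h1
  simp at h1; omega

lemma Bf_irr (n : ℕ) (hn : 0 < n) (g : SL2n n) (h : ¬ IsRationalForm n g) : Irr (Bf n g) := by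
  by_contra hI
  apply h
  simp only [Irr, not_exists] at hI
  obtain ⟨i0, j0, h0⟩ : ∃ i j, Mg n g i j ≠ 0 := by
    by_contra hc
    push Not at hc
    apply Bf_not_dec n 0 hn hn g
    intro x y
    have : Mg n g = 0 := by ext i j; exact hc i j
    simp [Bf, sympG_eq, this]
  have hq : ∀ i j, ∃ q : ℚ, Mg n g i j = q * Mg n g i0 j0 := by
    intro i j
    have := hI (Pi.single i 1) (Pi.single j 1) (Pi.single i0 1) (Pi.single j0 1)
    rw [Bf_single, Bf_single] at this
    exact comm_of_not_irr h0 this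
  choose q hq using hq
  let D : ℕ := ∏ p : Fin (2*n) × Fin (2*n), (q p.1 p.2).den
  have hD : D ≠ 0 := Finset.prod_ne_zero_iff.2 fun p _ => (q p.1 p.2).den_ne_zero
  refine ⟨(D : ℝ) / Mg n g i0 j0, div_ne_zero (by exact_mod_cast hD) h0, fun i j => ?_⟩
  obtain ⟨e, he⟩ : (q i j).den ∣ D :=
    Finset.dvd_prod_of_mem (fun p : Fin (2*n) × Fin (2*n) => (q p.1 p.2).den)
      (Finset.mem_univ (i, j))
  refine ⟨(q i j).num * e, ?_⟩
  change (D : ℝ) / Mg n g i0 j0 * Mg n g i j = _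
  rw [hq i j, he]
  have h1 : ((q i j).den : ℝ) * (q i j : ℝ) = (q i j).num := by
    exact_mod_cast Rat.den_mul_eq_num (q i j)
  push_cast
  field_simp
  linear_combination (e : ℝ) * h1

lemma not_dense_of_rational (n k : ℕ) (hk : 2 ≤ k) (g : SL2n n) (h : IsRationalForm n g) :
    ¬ Dense {t : Pairs k → ℝ |
      ∃ v : Fin k → (Fin (2*n) → ℤ), ∀ p : Pairs k,
        t p = sympG n g (fun j => ((v p.1.1 j : ℤ) : ℝ)) (fun j => ((v p.1.2 j : ℤ) : ℝ))} := by
  intro hd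
  obtain ⟨c, hc, hM⟩ := h
  choose M hM using hM
  let p0 : Pairs k := ⟨(⟨0, by omega⟩, ⟨1, by omega⟩), by simp [Fin.lt_def]⟩
  have hcont : Continuous fun t : Pairs k → ℝ => c * t p0 := by fun_prop
  obtain ⟨t, ⟨ht1, ht2⟩, ⟨v, hv⟩⟩ := hd.inter_open_nonempty _ (isOpen_Ioo.preimage hcont : IsOpen
    ((fun t : Pairs k → ℝ => c * t p0) ⁻¹' Set.Ioo (0:ℝ) 1)) ⟨fun _ => 1 / (2 * c), by
      simp only [Set.mem_preimage, Set.mem_Ioo]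
      have : c * (1 / (2 * c)) = 1 / 2 := by field_simp
      rw [this]; norm_num⟩
  have e : c * t p0 = ((∑ i, v p0.1.1 i * ∑ j, M i j * v p0.1.2 j : ℤ) : ℝ) := by
    rw [hv p0, sympG_eq]
    simp only [Matrix.mulVec, dotProduct]
    push_cast
    simp only [← hM, Finset.mul_sum]
    refine Finset.sum_congr rfl fun i _ => Finset.sum_congr rfl fun j _ => ?_
    simp only [Mg]; ring
  simp only at ht1 ht2
  rw [e] at ht1 ht2
  norm_cast at ht1 ht2
  omega

lemma dense_of_irrational (n k m : ℕ) (hn : 0 < n) (hm : m < n) (hkm : k ≤ 2 * m + 1)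
    (g : SL2n n) (h : ¬ IsRationalForm n g) :
    Dense {t : Pairs k → ℝ |
      ∃ v : Fin k → (Fin (2*n) → ℤ), ∀ p : Pairs k,
        t p = sympG n g (fun j => ((v p.1.1 j : ℤ) : ℝ)) (fun j => ((v p.1.2 j : ℤ) : ℝ))} := by
  rw [Metric.dense_iff]
  intro x r hr
  let G : Fin k → Fin k → ℝ := fun i j =>
    if h : i < j then x ⟨(i, j), h⟩ else if h : j < i then - x ⟨(j, i), h⟩ else 0
  have hG : ∀ i j, G i j = - G j i := by
    intro i j
    simp only [G]
    rcases lt_trichotomy i j with h | h | h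
    · rw [dif_pos h, dif_neg h.asymm, dif_pos h, neg_neg]
    · subst h; simp
    · rw [dif_pos h, dif_neg h.asymm, dif_pos h]
  obtain ⟨z, hz⟩ := approx_main m (Bf n g) (Bf_alt n hn g) (fun _ => Bf_irr n hn g h)
    (Bf_not_dec n m hn hm g) G (decG_fin hkm G hG) r hr
  refine ⟨fun p => Bf n g (z p.1.1) (z p.1.2), ?_, ⟨z, fun p => rfl⟩⟩
  rw [Metric.mem_ball, dist_pi_lt_iff hr]
  intro p
  have := hz p.1.1 p.1.2
  rw [Real.dist_eq]
  have hp : G p.1.1 p.1.2 = x p := by simp only [G]; rw [dif_pos p.2]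
  rwa [hp] at this

/-- Theorem 1.1 (qualitative Oppenheim for symplectic forms): for `n ≥ 2` and
`2 ≤ k ≤ n+2` (with `k ∈ {2,3}` when `n = 2`), the set of values
`(⟨v_i, v_j⟩^g)_{i<j}` over integer tuples is dense in `ℝ^{k(k-1)/2}`
iff the form is irrational. -/
theorem stmt0 (n k : ℕ) (hn : 2 ≤ n)
    (hk : (3 ≤ n ∧ 2 ≤ k ∧ k ≤ n + 2) ∨ (n = 2 ∧ (k = 2 ∨ k = 3)))
    (g : SL2n n) :
    Dense {t : Pairs k → ℝ |
      ∃ v : Fin k → (Fin (2*n) → ℤ), ∀ p : Pairs k,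
        t p = sympG n g (fun j => ((v p.1.1 j : ℤ) : ℝ)) (fun j => ((v p.1.2 j : ℤ) : ℝ))}
    ↔ ¬ IsRationalForm n g := by
  constructor
  · intro hd hr
    exact not_dense_of_rational n k (by omega) g hr hd
  · intro h
    exact dense_of_irrational n k (k / 2) (by omega) (by omega) (by omega) g h
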